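/- Let P be a dcpo and let 𝒞 be a family of closure systems in P. Then the intersection ⋂𝒞 = {x ∈ P | x ∈ C for every C ∈ 𝒞} is a closure system in P. (Consequently the closure systems in P, ordered by inclusion, form a complete lattice, and so does the pointwise-ordered set of closure operators on P.) -/

import Mathlib

/-- A dcpo: every nonempty directed subset has a least upper bound. -/
def IsDcpo (P : Type*) [PartialOrder P] : Prop :=
  ∀ D : Set P, D.Nonempty → DirectedOn (· ≤ ·) D → ∃ s, IsLUB D s

/-- A closure system: every element has a least element of the system above it. -/
def IsClosureSystem {P : Type*} [PartialOrder P] (C : Set P) : Prop :=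
  ∀ x : P, ∃ m, IsLeast {y | y ∈ C ∧ x ≤ y} m

/-- The monotone inflationary self-maps of `P` that fix every point of `F`. -/
def inflationaryFixing {P : Type*} [PartialOrder P] (F : Set P) : Set (P → P) :=
  {g | Monotone g ∧ (∀ x, x ≤ g x) ∧ ∀ y ∈ F, g y ≤ y}

theorem id_mem_inflationaryFixing {P : Type*} [PartialOrder P] (F : Set P) :
    id ∈ inflationaryFixing F :=
  ⟨monotone_id, fun _ => le_rfl, fun _ _ => le_rfl⟩

theorem comp_mem_inflationaryFixing {P : Type*} [PartialOrder P] {F : Set P} {f g : P → P}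
    (hf : f ∈ inflationaryFixing F) (hg : g ∈ inflationaryFixing F) :
    f ∘ g ∈ inflationaryFixing F :=
  ⟨hf.1.comp hg.1, fun x => (hg.2.1 x).trans (hf.2.1 _),
    fun y hy => (hf.1 (hg.2.2 y hy)).trans (hf.2.2 y hy)⟩

/-- Pataraia's argument: in a dcpo the monotone inflationary maps fixing `F` have a greatest
element. -/
theorem IsDcpo.exists_isGreatest_inflationaryFixing {P : Type*} [PartialOrder P]
    (hP : IsDcpo P) (F : Set P) : ∃ t, IsGreatest (inflationaryFixing F) t := by
  have hsup (x : P) : ∃ s, IsLUB ((fun g : P → P => g x) '' inflationaryFixing F) s := by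
    apply hP
    · exact ⟨_, id, id_mem_inflationaryFixing F, rfl⟩
    · rintro _ ⟨f, hf, rfl⟩ _ ⟨g, hg, rfl⟩
      exact ⟨_, ⟨f ∘ g, comp_mem_inflationaryFixing hf hg, rfl⟩, hf.1 (hg.2.1 x), hf.2.1 (g x)⟩
  choose t ht using hsup
  have le_t {g : P → P} (hg : g ∈ inflationaryFixing F) (x : P) : g x ≤ t x :=
    (ht x).1 ⟨g, hg, rfl⟩
  refine ⟨t, ⟨fun a b hab => (ht a).2 ?_, le_t (id_mem_inflationaryFixing F),
    fun y hy => (ht y).2 ?_⟩, fun g hg => le_t hg⟩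
  · rintro _ ⟨g, hg, rfl⟩
    exact (hg.1 hab).trans (le_t hg b)
  · rintro _ ⟨g, hg, rfl⟩
    exact hg.2.2 y hy

/-- A closure system is the range of a monotone inflationary map fixing each of its points. -/
theorem IsClosureSystem.exists_mem_inflationaryFixing {P : Type*} [PartialOrder P] {C : Set P}
    (hC : IsClosureSystem C) : ∃ f ∈ inflationaryFixing C, ∀ x, f x ∈ C := by
  choose f hf using hC
  exact ⟨f, ⟨fun a b hab => (hf a).2 ⟨(hf b).1.1, hab.trans (hf b).1.2⟩,
    fun x => (hf x).1.2, fun y hy => (hf y).2 ⟨hy, le_rfl⟩⟩, fun x => (hf x).1.1⟩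

theorem stmt3 {P : Type*} [PartialOrder P] (hP : IsDcpo P)
    (𝒞 : Set (Set P)) (h𝒞 : ∀ C ∈ 𝒞, IsClosureSystem C) :
    IsClosureSystem {x : P | ∀ C ∈ 𝒞, x ∈ C} := by
  intro x
  obtain ⟨t, ht, ht_max⟩ := hP.exists_isGreatest_inflationaryFixing {x : P | ∀ C ∈ 𝒞, x ∈ C}
  refine ⟨t x, ⟨fun C hC => ?_, ht.2.1 x⟩, fun y hy => (ht.1 hy.2).trans (ht.2.2 y hy.1)⟩
  obtain ⟨f, hf, hfC⟩ := (h𝒞 C hC).exists_mem_inflationaryFixing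
  have hft : f ∘ t ∈ inflationaryFixing {x : P | ∀ C ∈ 𝒞, x ∈ C} :=
    comp_mem_inflationaryFixing ⟨hf.1, hf.2.1, fun y hy => hf.2.2 y (hy C hC)⟩ ht
  have heq : f (t x) = t x := le_antisymm (ht_max hft x) (hf.2.1 (t x))
  exact heq ▸ hfC (t x)
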